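/- arXiv:math/0210375 — 5 statements merged into one kernel-verified Lean document; each statement's English description precedes it below -/
import Mathlib

section
/- Let m, n, r be positive integers with r ≤ m ≤ n, and let Y be a two-sided sub-ladder of X determined by paths C (from (k_1,n) to (m,k_2)) and C̃ (from (1,k_3) to (k_4,1)). Let P_1, …, P_r and Q_1, …, Q_r be points of Y such that: (i) P_i = (a_i, n) with 1 = a_1 < a_2 < … < a_r ≤ m; (ii) Q_i = (c_i, d_i) with 1 ≤ c_1 ≤ c_2 ≤ … ≤ c_r = m and 1 = d_1 < d_2 < … < d_r ≤ n; (iii) c_1 > k_2 whenever k_2 ≥ 2. Then the number of r-tuples of non-intersecting paths in Y from P_1, …, P_r to Q_1, …, Q_r equals det[w(P_i, Q_j)]_{i,j=1,…,r}. -/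
/-- A (lattice) path in `Y` from `P` to `Q`: a nonempty finite sequence of points of `Y`
starting at `P`, ending at `Q`, each step either increases the first coordinate by 1 or
decreases the second coordinate by 1. -/
def LPath (Y : Set (ℤ × ℤ)) (P Q : ℤ × ℤ) (c : List (ℤ × ℤ)) : Prop :=
  c.head? = some P ∧ c.getLast? = some Q ∧ (∀ p ∈ c, p ∈ Y) ∧
  List.Chain' (fun p q : ℤ × ℤ => q = (p.1 + 1, p.2) ∨ q = (p.1, p.2 - 1)) c

/-- `w(P,Q)`: the number of paths in `Y` from `P` to `Q`. -/
noncomputable def pathCount (Y : Set (ℤ × ℤ)) (P Q : ℤ × ℤ) : ℕ :=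
  Nat.card {c : List (ℤ × ℤ) // LPath Y P Q c}

/-- The number of `r`-tuples of pairwise non-intersecting paths in `Y` from `P i` to `Q i`. -/
noncomputable def nipCount (Y : Set (ℤ × ℤ)) {r : ℕ} (P Q : Fin r → ℤ × ℤ) : ℕ :=
  Nat.card {C : Fin r → List (ℤ × ℤ) //
    (∀ i, LPath Y (P i) (Q i) (C i)) ∧
    ∀ i j, i ≠ j → ∀ p ∈ C i, p ∉ C j}

section ListSplice

variable {α : Type*} [DecidableEq α]

/-- The initial part of `A` strictly before `p`, followed by the part of `B` from `p` on. -/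
def splice (p : α) (A B : List α) : List α :=
  A.takeWhile (· ≠ p) ++ B.dropWhile (· ≠ p)

theorem takeWhile_ne_append_cons {p : α} {s t : List α} (hs : p ∉ s) :
    (s ++ p :: t).takeWhile (· ≠ p) = s := by
  rw [List.takeWhile_append_of_pos (by intro q hq; simpa using ne_of_mem_of_not_mem hq hs)]
  simp

theorem dropWhile_ne_append_cons {p : α} {s t : List α} (hs : p ∉ s) :
    (s ++ p :: t).dropWhile (· ≠ p) = p :: t := by
  rw [List.dropWhile_append_of_pos (by intro q hq; simpa using ne_of_mem_of_not_mem hq hs)]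
  simp

theorem splice_self (p : α) (A : List α) : splice p A A = A :=
  List.takeWhile_append_dropWhile

theorem mem_splice_iff {p : α} {A B : List α} : p ∈ splice p A B ↔ p ∈ B := by
  have h1 : p ∉ A.takeWhile (· ≠ p) := fun h => by simpa using List.mem_takeWhile_imp h
  have h2 : p ∉ B.takeWhile (· ≠ p) := fun h => by simpa using List.mem_takeWhile_imp h
  conv_rhs => rw [← splice_self p B]
  simp only [splice, List.mem_append, h1, h2, false_or]

theorem takeWhile_splice (p : α) (A B : List α) :
    (splice p A B).takeWhile (· ≠ p) = A.takeWhile (· ≠ p) := by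
  have h1 : p ∉ A.takeWhile (· ≠ p) := fun h => by simpa using List.mem_takeWhile_imp h
  by_cases hB : p ∈ B
  · obtain ⟨s, t, rfl, hs⟩ := List.eq_append_cons_of_mem hB
    rw [splice, dropWhile_ne_append_cons hs, takeWhile_ne_append_cons h1]
  · have : B.dropWhile (· ≠ p) = [] := by
      rw [List.dropWhile_eq_nil_iff]
      intro q hq
      simpa using ne_of_mem_of_not_mem hq hB
    rw [splice, this, List.append_nil, List.takeWhile_takeWhile]
    simp

theorem dropWhile_splice (p : α) (A B : List α) :
    (splice p A B).dropWhile (· ≠ p) = B.dropWhile (· ≠ p) := by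
  have h := splice_self p (splice p A B)
  rw [splice, takeWhile_splice] at h
  exact List.append_cancel_left h

theorem splice_splice (p : α) (A B A' B' : List α) :
    splice p (splice p A B) (splice p A' B') = splice p A B' := by
  rw [splice, takeWhile_splice, dropWhile_splice, splice]

/-- Exchange of the tails from `p` on between the lists with indices `i` and `j`. -/
def tailSwap {ι : Type*} [DecidableEq ι] (p : α) (i j : ι) (C : ι → List α) : ι → List α :=
  fun k => splice p (C k) (C (Equiv.swap i j k))

theorem tailSwap_tailSwap {ι : Type*} [DecidableEq ι] (p : α) (i j : ι) (C : ι → List α) :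
    tailSwap p i j (tailSwap p i j C) = C := by
  funext k
  simp only [tailSwap, splice_splice, Equiv.swap_apply_self, splice_self]

theorem mem_tailSwap_iff {ι : Type*} [DecidableEq ι] {p : α} {i j : ι} {C : ι → List α}
    (hi : p ∈ C i) (hj : p ∈ C j) (k : ι) : p ∈ tailSwap p i j C k ↔ p ∈ C k := by
  rw [tailSwap, mem_splice_iff]
  rcases eq_or_ne k i with rfl | hki
  · simp [hi, hj]
  rcases eq_or_ne k j with rfl | hkj
  · simp [hi, hj]
  rw [Equiv.swap_apply_of_ne_of_ne hki hkj]

theorem sum_count_tailSwap {ι : Type*} [DecidableEq ι] [Fintype ι] (p q : α) (i j : ι)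
    (C : ι → List α) : ∑ k, (tailSwap p i j C k).count q = ∑ k, (C k).count q := by
  conv_rhs => enter [2, k]; rw [← splice_self p (C k)]
  simp only [tailSwap, splice, List.count_append, Finset.sum_add_distrib]
  congr 1
  exact Equiv.sum_comp (Equiv.swap i j) fun k => ((C k).dropWhile (· ≠ p)).count q

theorem one_lt_sum_count_iff {ι : Type*} [DecidableEq ι] [Fintype ι] {C : ι → List α}
    (hC : ∀ k, (C k).Nodup) (q : α) :
    1 < ∑ k, (C k).count q ↔ ∃ ij : ι × ι, ij.1 ≠ ij.2 ∧ q ∈ C ij.1 ∧ q ∈ C ij.2 := by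
  have h : ∑ k, (C k).count q = (Finset.univ.filter fun k => q ∈ C k).card := by
    rw [Finset.card_filter]
    exact Finset.sum_congr rfl fun k _ => (hC k).count
  rw [h, Finset.one_lt_card]
  constructor
  · rintro ⟨i, hi, j, hj, hij⟩
    exact ⟨(i, j), hij, by simpa using hi, by simpa using hj⟩
  · rintro ⟨⟨i, j⟩, hij, hi, hj⟩
    exact ⟨i, by simpa using hi, j, by simpa using hj, hij⟩

end ListSplice

namespace LPath

variable {Y : Set (ℤ × ℤ)} {P Q P' Q' p : ℤ × ℤ} {A B : List (ℤ × ℤ)}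

theorem cases_cons (h : LPath Y P Q A) :
    A = [P] ∧ P = Q ∨ ∃ R B, A = P :: B ∧ (R = (P.1 + 1, P.2) ∨ R = (P.1, P.2 - 1)) ∧
      LPath Y R Q B := by
  obtain ⟨h1, h2, h3, h4⟩ := h
  match A, h1 with
  | [_], h1 => simp_all
  | x :: y :: B, h1 =>
    obtain rfl : x = P := by simpa using h1
    refine Or.inr ⟨y, y :: B, rfl, ?_⟩
    rw [List.Chain', List.isChain_cons_cons] at h4
    exact ⟨h4.1, rfl, by simpa using h2, fun q hq => h3 q (List.mem_cons_of_mem _ hq), h4.2⟩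

theorem start_mem (h : LPath Y P Q A) : P ∈ A := List.mem_of_mem_head? h.1

theorem mem_box (h : LPath Y P Q A) : ∀ p ∈ A, p ∈ Set.Icc P.1 Q.1 ×ˢ Set.Icc Q.2 P.2 := by
  induction A generalizing P with
  | nil => simp
  | cons x A ih =>
    rcases h.cases_cons with ⟨h1, rfl⟩ | ⟨R, B, h1, h2, h3⟩
    · simp [h1]
    · obtain ⟨rfl, rfl⟩ := List.cons.inj h1
      have h4 := ih h3
      have h5 := h4 R h3.start_mem
      simp only [Set.mem_prod, Set.mem_Icc] at h4 h5 ⊢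
      intro p hp
      rcases List.mem_cons.1 hp with rfl | hp
      · rcases h2 with rfl | rfl <;> simp only at h5 <;> omega
      · have := h4 p hp
        rcases h2 with rfl | rfl <;> simp only at this <;> omega

theorem nodup (h : LPath Y P Q A) : A.Nodup := by
  have h1 : A.IsChain fun p q => p.1 - p.2 < q.1 - q.2 := by
    refine h.2.2.2.imp fun p q hpq => ?_
    rcases hpq with rfl | rfl <;> simp only <;> omega
  have : IsTrans (ℤ × ℤ) fun p q => p.1 - p.2 < q.1 - q.2 := ⟨fun _ _ _ => lt_trans⟩
  exact h1.pairwise.imp fun hpq e => by subst e; exact lt_irrefl _ hpq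

theorem finite (Y : Set (ℤ × ℤ)) (P Q : ℤ × ℤ) : {A | LPath Y P Q A}.Finite := by
  let box : Finset (ℤ × ℤ) := Finset.Icc P.1 Q.1 ×ˢ Finset.Icc Q.2 P.2
  refine (box.powerset.finite_toSet.biUnion fun t _ =>
    t.toList.permutations.finite_toSet).subset fun A hA => ?_
  simp only [Set.mem_iUnion]
  refine ⟨A.toFinset, ?_, ?_⟩
  · simp only [Finset.mem_coe, Finset.mem_powerset]
    intro p hp
    simpa only [box, Finset.mem_product, Finset.mem_Icc, Set.mem_prod, Set.mem_Icc] using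
      mem_box hA p (by simpa using hp)
  · exact List.mem_permutations.2 ((List.toFinset_toList (nodup hA)).symm)

theorem splice (hA : LPath Y P Q A) (hB : LPath Y P' Q' B) (hpA : p ∈ A) (hpB : p ∈ B) :
    LPath Y P Q' (splice p A B) := by
  obtain ⟨s, t, rfl, hs⟩ := List.eq_append_cons_of_mem hpA
  obtain ⟨s', t', rfl, hs'⟩ := List.eq_append_cons_of_mem hpB
  rw [_root_.splice, takeWhile_ne_append_cons hs, dropWhile_ne_append_cons hs']
  obtain ⟨hA1, -, hA3, hA4⟩ := hA
  obtain ⟨-, hB2, hB3, hB4⟩ := hB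
  rw [List.Chain', List.isChain_split] at hA4 hB4
  refine ⟨?_, ?_, ?_, List.isChain_split.2 ⟨hA4.1, hB4.2⟩⟩
  · simpa using hA1
  · simpa using hB2
  · intro q hq
    rcases List.mem_append.1 hq with hq | hq
    · exact hA3 q (List.mem_append_left _ hq)
    · exact hB3 q (List.mem_append_right _ hq)

/-- A path starting weakly above and to the left of another one, and ending weakly below and to
the right of it, meets it. -/
theorem exists_mem_inter (hA : LPath Y P Q A) (hB : LPath Y P' Q' B)
    (h1 : P.1 ≤ P'.1) (h2 : P.2 ≤ P'.2) (h3 : Q'.1 ≤ Q.1) (h4 : Q'.2 ≤ Q.2) :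
    ∃ p ∈ A, p ∈ B := by
  induction hN : A.length + B.length using Nat.strong_induction_on generalizing A B P P' with
  | _ N ih =>
  have hA' := hA.mem_box P hA.start_mem
  have hB' := hB.mem_box P' hB.start_mem
  simp only [Set.mem_prod, Set.mem_Icc] at hA' hB'
  rcases h1.lt_or_eq with h1' | h1'
  · rcases hA.cases_cons with ⟨-, rfl⟩ | ⟨R, A', rfl, hR, hRA⟩
    · omega
    · obtain ⟨p, hp, hp'⟩ := ih _ (by rw [← hN, List.length_cons]; omega) hRA hB
        (by rcases hR with rfl | rfl <;> simp only <;> omega)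
        (by rcases hR with rfl | rfl <;> simp only <;> omega) rfl
      exact ⟨p, List.mem_cons_of_mem _ hp, hp'⟩
  rcases h2.lt_or_eq with h2' | h2'
  · rcases hB.cases_cons with ⟨-, rfl⟩ | ⟨R, B', rfl, hR, hRB⟩
    · omega
    · obtain ⟨p, hp, hp'⟩ := ih _ (by rw [← hN, List.length_cons]; omega) hA hRB
        (by rcases hR with rfl | rfl <;> simp only <;> omega)
        (by rcases hR with rfl | rfl <;> simp only <;> omega) rfl
      exact ⟨p, hp, List.mem_cons_of_mem _ hp'⟩
  · obtain rfl : P = P' := Prod.ext h1' h2'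
    exact ⟨P, hA.start_mem, hB.start_mem⟩

theorem tailSwap {r : ℕ} {P Q : Fin r → ℤ × ℤ} {C : Fin r → List (ℤ × ℤ)}
    (hC : ∀ k, LPath Y (P k) (Q k) (C k)) {i j : Fin r} (hi : p ∈ C i) (hj : p ∈ C j)
    (k : Fin r) : LPath Y (P k) (Q (Equiv.swap i j k)) (tailSwap p i j C k) := by
  rw [_root_.tailSwap]
  rcases eq_or_ne k i with rfl | hki
  · rw [Equiv.swap_apply_left]
    exact (hC k).splice (hC j) hi hj
  rcases eq_or_ne k j with rfl | hkj
  · rw [Equiv.swap_apply_right]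
    exact (hC k).splice (hC i) hj hi
  rw [Equiv.swap_apply_of_ne_of_ne hki hkj, splice_self]
  exact hC k

end LPath

/-- The finite set of paths in `Y` from `P` to `Q`. -/
noncomputable def pathFinset (Y : Set (ℤ × ℤ)) (P Q : ℤ × ℤ) : Finset (List (ℤ × ℤ)) :=
  (LPath.finite Y P Q).toFinset

theorem mem_pathFinset {Y : Set (ℤ × ℤ)} {P Q : ℤ × ℤ} {A : List (ℤ × ℤ)} :
    A ∈ pathFinset Y P Q ↔ LPath Y P Q A := by
  simp [pathFinset]

theorem pathCount_eq_card (Y : Set (ℤ × ℤ)) (P Q : ℤ × ℤ) :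
    pathCount Y P Q = (pathFinset Y P Q).card :=
  Nat.subtype_card _ fun _ => mem_pathFinset

section SignReversal

variable {α ι : Type*} [DecidableEq α] [DecidableEq ι] [Fintype ι]

/-- The points lying on at least two of the lists, counted with multiplicity. -/
def multiPoints (C : ι → List α) : Set α :=
  {q | 1 < ∑ k, (C k).count q}

variable {C : ι → List α}

theorem multiPoints_tailSwap (p : α) (i j : ι) :
    multiPoints (tailSwap p i j C) = multiPoints C := by
  simp only [multiPoints, sum_count_tailSwap]

theorem multiPoints_nonempty_iff (hC : ∀ k, (C k).Nodup) :
    (multiPoints C).Nonempty ↔ ¬ ∀ i j, i ≠ j → ∀ p ∈ C i, p ∉ C j := by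
  simp only [Set.Nonempty, multiPoints, Set.mem_ofPred_eq, one_lt_sum_count_iff hC]
  push Not
  constructor
  · rintro ⟨p, ⟨i, j⟩, h⟩
    exact ⟨i, j, h.1, p, h.2⟩
  · rintro ⟨i, j, h, p, h'⟩
    exact ⟨p, (i, j), h, h'⟩

variable [Nonempty α] [Nonempty (ι × ι)]

/-- A point of `multiPoints C`, depending only on that set. -/
noncomputable def chosenPoint (C : ι → List α) : α :=
  Classical.epsilon (· ∈ multiPoints C)

/-- Two different indices of lists through the chosen point, depending only on the set of such
indices. -/
noncomputable def chosenPair (C : ι → List α) : ι × ι :=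
  Classical.epsilon fun ij => ij.1 ≠ ij.2 ∧ chosenPoint C ∈ C ij.1 ∧ chosenPoint C ∈ C ij.2

/-- The sign-reversing involution of Lindström, Gessel and Viennot. -/
noncomputable def signReversal (x : Σ _ : Equiv.Perm ι, ι → List α) :
    Σ _ : Equiv.Perm ι, ι → List α :=
  ⟨x.1 * Equiv.swap (chosenPair x.2).1 (chosenPair x.2).2,
    tailSwap (chosenPoint x.2) (chosenPair x.2).1 (chosenPair x.2).2 x.2⟩

theorem chosenPair_spec (hC : ∀ k, (C k).Nodup)
    (h : (multiPoints C).Nonempty) :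
    (chosenPair C).1 ≠ (chosenPair C).2 ∧ chosenPoint C ∈ C (chosenPair C).1 ∧
      chosenPoint C ∈ C (chosenPair C).2 :=
  Classical.epsilon_spec ((one_lt_sum_count_iff hC _).1 (Classical.epsilon_spec h))

theorem signReversal_signReversal (σ : Equiv.Perm ι)
    (hC : ∀ k, (C k).Nodup) (h : (multiPoints C).Nonempty) :
    signReversal (signReversal ⟨σ, C⟩) = ⟨σ, C⟩ := by
  obtain ⟨-, hi, hj⟩ := chosenPair_spec hC h
  have h1 : chosenPoint (signReversal ⟨σ, C⟩).2 = chosenPoint C := by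
    simp only [chosenPoint, signReversal, multiPoints_tailSwap]
  have h2 : chosenPair (signReversal ⟨σ, C⟩).2 = chosenPair C := by
    rw [chosenPair, h1]
    simp only [signReversal, mem_tailSwap_iff hi hj]
    rfl
  rw [signReversal, h1, h2]
  simp only [signReversal, tailSwap_tailSwap, mul_assoc, Equiv.swap_mul_self, mul_one]

end SignReversal

theorem Equiv.Perm.exists_inversion {r : ℕ} {σ : Equiv.Perm (Fin r)} (hσ : σ ≠ 1) :
    ∃ i j, i < j ∧ σ j < σ i := by
  by_contra! h
  have hm : StrictMono σ := fun i j hij => (h i j hij).lt_of_ne (σ.injective.ne hij.ne)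
  refine hσ (Equiv.ext fun i => ?_)
  exact congrFun (congrArg DFunLike.coe
    (Subsingleton.elim (StrictMono.orderIsoOfSurjective σ hm σ.surjective) (OrderIso.refl _))) i

/-- The Lindström–Gessel–Viennot lemma for lattice paths in the plane. -/
theorem nipCount_eq_det {r : ℕ} (Y : Set (ℤ × ℤ)) (P Q : Fin r → ℤ × ℤ)
    (hPQ : ∀ i j i' j', i < j → j' < i' → ∀ A B, LPath Y (P i) (Q i') A →
      LPath Y (P j) (Q j') B → ∃ p ∈ A, p ∈ B) :
    (nipCount Y P Q : ℤ) =
      Matrix.det (Matrix.of fun i j : Fin r => (pathCount Y (P i) (Q j) : ℤ)) := by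
  classical
  let NI : (Fin r → List (ℤ × ℤ)) → Prop := fun C => ∀ i j, i ≠ j → ∀ p ∈ C i, p ∉ C j
  let F : Equiv.Perm (Fin r) → Finset (Fin r → List (ℤ × ℤ)) := fun σ =>
    Fintype.piFinset fun i => pathFinset Y (P i) (Q (σ i))
  have mem_F {σ C} : C ∈ F σ ↔ ∀ i, LPath Y (P i) (Q (σ i)) (C i) := by
    simp only [F, Fintype.mem_piFinset, mem_pathFinset]
  have hdet : Matrix.det (Matrix.of fun i j : Fin r => (pathCount Y (P i) (Q j) : ℤ)) =
      ∑ x ∈ Finset.univ.sigma F, (Equiv.Perm.sign x.1 : ℤ) := by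
    rw [← Matrix.det_transpose, Matrix.det_apply', Finset.sum_sigma]
    refine Finset.sum_congr rfl fun σ _ => ?_
    simp [F, Fintype.card_piFinset, pathCount_eq_card, mul_comm]
  have hcancel : ∑ x ∈ (Finset.univ.sigma F).filter (fun x => ¬ NI x.2),
      (Equiv.Perm.sign x.1 : ℤ) = 0 := by
    rcases isEmpty_or_nonempty (Fin r × Fin r) with hr | hr
    · rw [Finset.filter_false_of_mem, Finset.sum_empty]
      exact fun x _ hx => hx fun i j => (hr.false (i, j)).elim
    have key {x} (hx : x ∈ (Finset.univ.sigma F).filter fun x => ¬ NI x.2) :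
        (∀ i, LPath Y (P i) (Q (x.1 i)) (x.2 i)) ∧ (multiPoints x.2).Nonempty := by
      simp only [Finset.mem_filter, Finset.mem_sigma, Finset.mem_univ, true_and, mem_F] at hx
      exact ⟨hx.1, (multiPoints_nonempty_iff fun k => (hx.1 k).nodup).2 hx.2⟩
    refine Finset.sum_involution (fun x _ => signReversal x) ?_ ?_ ?_ ?_
    · intro x hx
      obtain ⟨h1, h2⟩ := key hx
      simp [signReversal,
        Equiv.Perm.sign_swap (chosenPair_spec (fun k => (h1 k).nodup) h2).1]
    · intro x hx _ he
      obtain ⟨h1, h2⟩ := key hx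
      refine (chosenPair_spec (fun k => (h1 k).nodup) h2).1 ?_
      rw [← Equiv.swap_eq_one_iff]
      exact mul_eq_left.1 (congrArg Sigma.fst he)
    · intro x hx
      obtain ⟨h1, h2⟩ := key hx
      obtain ⟨-, hi, hj⟩ := chosenPair_spec (fun k => (h1 k).nodup) h2
      have h3 := LPath.tailSwap h1 hi hj
      simp only [Finset.mem_filter, Finset.mem_sigma, Finset.mem_univ, true_and, mem_F]
      refine ⟨h3, (multiPoints_nonempty_iff fun k => (h3 k).nodup).1 ?_⟩
      rwa [multiPoints_tailSwap]
    · intro x hx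
      obtain ⟨h1, h2⟩ := key hx
      exact signReversal_signReversal x.1 (fun k => (h1 k).nodup) h2
  have hcount : nipCount Y P Q = ((F 1).filter NI).card :=
    Nat.subtype_card _ fun C => by
      simp only [Finset.mem_filter, mem_F, Equiv.Perm.one_apply, NI]
  rw [hdet, ← Finset.sum_filter_add_sum_filter_not _ (fun x => NI x.2), hcancel, add_zero,
    Finset.sum_filter, Finset.sum_sigma, Finset.sum_eq_single 1]
  · simp only [hcount, Finset.card_filter, Nat.cast_sum, Nat.cast_ite, Nat.cast_one, Nat.cast_zero,
      Equiv.Perm.sign_one, Units.val_one]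
  · intro σ _ hσ
    refine Finset.sum_eq_zero fun C hC => if_neg fun hNI => ?_
    obtain ⟨i, j, hij, hji⟩ := Equiv.Perm.exists_inversion hσ
    rw [mem_F] at hC
    obtain ⟨p, hp, hp'⟩ := hPQ i j _ _ hij hji _ _ (hC i) (hC j)
    exact hNI i j hij.ne p hp hp'
  · simp

theorem stmt4 (m n r : ℕ) (hr : 0 < r) (hrm : r ≤ m) (hmn : m ≤ n)
    (k₁ k₂ k₃ k₄ : ℤ)
    (hk₁ : 1 < k₁) (hk₁m : k₁ ≤ (m : ℤ)) (hk₂ : 1 < k₂) (hk₂n : k₂ ≤ (n : ℤ))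
    (hk₃ : 1 ≤ k₃) (hk₃n : k₃ < (n : ℤ)) (hk₄ : 1 ≤ k₄) (hk₄m : k₄ < (m : ℤ))
    (X : Set (ℤ × ℤ))
    (hX : X = {p : ℤ × ℤ | 1 ≤ p.1 ∧ p.1 ≤ (m : ℤ) ∧ 1 ≤ p.2 ∧ p.2 ≤ (n : ℤ)})
    (Cp Ct : List (ℤ × ℤ))
    (hCp : LPath X (k₁, (n : ℤ)) ((m : ℤ), k₂) Cp)
    (hCt : LPath X (1, k₃) (k₄, 1) Ct)
    -- `u i` is the upper boundary of row `i` of the ladder `Y`: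
    (u : ℤ → ℤ)
    (hu1 : ∀ i, i < k₁ → u i = (n : ℤ))
    (hu2 : ∀ i, k₁ ≤ i → i ≤ (m : ℤ) → (i, u i) ∈ Cp ∧ ∀ j, (i, j) ∈ Cp → j ≤ u i)
    -- `l i` is the lower boundary of row `i` of the ladder `Y`:
    (l : ℤ → ℤ)
    (hl1 : ∀ i, k₄ < i → l i = 1)
    (hl2 : ∀ i, 1 ≤ i → i ≤ k₄ → (i, l i) ∈ Ct ∧ ∀ j, (i, j) ∈ Ct → l i ≤ j)
    (Y : Set (ℤ × ℤ))
    (hY : Y = {p : ℤ × ℤ | 1 ≤ p.1 ∧ p.1 ≤ (m : ℤ) ∧ l p.1 ≤ p.2 ∧ p.2 ≤ u p.1})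
    -- the points P_i = (a_i, n) and Q_i = (c_i, d_i):
    (a c d : Fin r → ℤ)
    (ha0 : a ⟨0, hr⟩ = 1) (ha : StrictMono a) (ham : ∀ i, a i ≤ (m : ℤ))
    (hc : Monotone c) (hc1 : ∀ i, 1 ≤ c i) (hcr : c ⟨r - 1, Nat.sub_lt hr one_pos⟩ = (m : ℤ))
    (hd0 : d ⟨0, hr⟩ = 1) (hd : StrictMono d) (hdn : ∀ i, d i ≤ (n : ℤ))
    (hPY : ∀ i, ((a i, (n : ℤ)) : ℤ × ℤ) ∈ Y) (hQY : ∀ i, ((c i, d i) : ℤ × ℤ) ∈ Y)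
    (hck₂ : 2 ≤ k₂ → k₂ < c ⟨0, hr⟩) :
    (nipCount Y (fun i => (a i, (n : ℤ))) (fun i => (c i, d i)) : ℤ) =
      Matrix.det (Matrix.of fun i j : Fin r =>
        (pathCount Y (a i, (n : ℤ)) (c j, d j) : ℤ)) := by
  refine nipCount_eq_det Y _ _ fun i j i' j' hij hji A B hA hB => ?_
  exact hA.exists_mem_inter hB (ha hij).le le_rfl (hc hji.le) (hd hji).le
end

section
/- Let m, n, k, l be integers with m ≥ 2, 0 ≤ k ≤ m−2 and 0 ≤ l ≤ n−2. Then Σ_{(a,b)∈T} (−1)^{a+b} C(m+k−2, m−1+a(k−m)+b(l−n)) = 0. -/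
/-- The binomial coefficient `C(N, x)` for integers, with the convention that it is `0`
when `N < 0`, `x < 0`, or `x > N`. -/
def ibinom (N x : ℤ) : ℤ :=
  if 0 ≤ N ∧ 0 ≤ x then (N.toNat.choose x.toNat : ℤ) else 0

/-- The index set `T = {(a,b) : a − b = 0 or a − b = 1}`. -/
def Tset : Set (ℤ × ℤ) := {p : ℤ × ℤ | p.1 - p.2 = 0 ∨ p.1 - p.2 = 1}

theorem ibinom_symm {N x y : ℤ} (hN : 0 ≤ N) (h : x + y = N) : ibinom N x = ibinom N y := by
  wlog hxy : x ≤ y generalizing x y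
  · exact (this (by omega) (by omega)).symm
  have hy : 0 ≤ y := by omega
  unfold ibinom
  by_cases hx : 0 ≤ x
  · rw [if_pos ⟨hN, hx⟩, if_pos ⟨hN, hy⟩,
      Nat.choose_symm_of_eq_add (show N.toNat = x.toNat + y.toNat by omega)]
  · rw [if_neg (fun hc => hx hc.2), if_pos ⟨hN, hy⟩,
      Nat.choose_eq_zero_of_lt (show N.toNat < y.toNat by omega), Nat.cast_zero]

/-- The involution `(a, b) ↦ (1 - a, -b)` of `ℤ × ℤ`. -/
def reflection : ℤ × ℤ ≃ ℤ × ℤ := (Equiv.subLeft 1).prodCongr (Equiv.neg ℤ)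

theorem reflection_apply (p : ℤ × ℤ) : reflection p = (1 - p.1, -p.2) := rfl

theorem reflection_mem_Tset (p : ℤ × ℤ) : reflection p ∈ Tset ↔ p ∈ Tset := by
  simp only [reflection_apply, Tset, Set.mem_ofPred_eq]
  omega

theorem neg_one_pow_natAbs_one_sub (c : ℤ) :
    (-1 : ℤ) ^ (1 - c).natAbs = -(-1 : ℤ) ^ c.natAbs := by
  rcases Int.even_or_odd c with h | h
  · rw [(Int.natAbs_even.2 h).neg_one_pow,
      (Int.natAbs_odd.2 (odd_one.sub_even h)).neg_one_pow]
  · rw [(Int.natAbs_odd.2 h).neg_one_pow,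
      (Int.natAbs_even.2 (odd_one.sub_odd h)).neg_one_pow, neg_neg]

theorem finsum_mem_eq_zero_of_equiv_neg {α : Type*} {s : Set α} {f : α → ℤ} (e : α ≃ α)
    (hs : ∀ a, e a ∈ s ↔ a ∈ s) (hf : ∀ a, f (e a) = -f a) : ∑ᶠ a ∈ s, f a = 0 := by
  have h : ∑ᶠ a ∈ s, f a = -∑ᶠ a ∈ s, f a := by
    rw [← finsum_neg_distrib, ← finsum_comp_equiv e]
    refine finsum_congr fun a => ?_
    simp only [hs, hf, finsum_neg_distrib]
  omega

theorem stmt8 (m n k l : ℤ) (hm : 2 ≤ m) (hk0 : 0 ≤ k) (hk : k ≤ m - 2)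
    (hl0 : 0 ≤ l) (hl : l ≤ n - 2) :
    ∑ᶠ p ∈ Tset, (-1 : ℤ) ^ (p.1 + p.2).natAbs *
      ibinom (m + k - 2) (m - 1 + p.1 * (k - m) + p.2 * (l - n)) = 0 := by
  refine finsum_mem_eq_zero_of_equiv_neg reflection reflection_mem_Tset fun p => ?_
  simp only [reflection_apply]
  rw [show 1 - p.1 + -p.2 = 1 - (p.1 + p.2) by ring, neg_one_pow_natAbs_one_sub, neg_mul,
    ibinom_symm (by omega) (show _ + (m - 1 + p.1 * (k - m) + p.2 * (l - n)) = _ by ring)]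
end

section
/- Let m, n, k, l, t be integers with 0 ≤ k < m, 0 ≤ l < n, t > l and k ≤ n − t. Then Σ_{(a,b)∈T} (−1)^{a+b} C(m+n−t−2, m−2+a(k−m)+b(l−n)) = C(m+n−t−2, m−2) − C(m+n−t−2, k−2). -/
theorem ibinom_eq_zero_of_neg {N x : ℤ} (hx : x < 0) : ibinom N x = 0 :=
  if_neg fun h => by omega

theorem ibinom_eq_zero_of_lt {N x : ℤ} (hx : N < x) : ibinom N x = 0 := by
  unfold ibinom
  split_ifs with h
  · rw [Nat.choose_eq_zero_of_lt (by omega), Nat.cast_zero]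
  · rfl

theorem stmt10 (m n k l t : ℤ) (hk0 : 0 ≤ k) (hkm : k < m) (hl0 : 0 ≤ l) (hln : l < n)
    (htl : l < t) (hkt : k ≤ n - t) :
    ∑ᶠ p ∈ Tset, (-1 : ℤ) ^ (p.1 + p.2).natAbs *
      ibinom (m + n - t - 2) (m - 2 + p.1 * (k - m) + p.2 * (l - n)) =
      ibinom (m + n - t - 2) (m - 2) - ibinom (m + n - t - 2) (k - 2) := by
  have key : ∀ p ∈ Tset, ibinom (m + n - t - 2) (m - 2 + p.1 * (k - m) + p.2 * (l - n)) ≠ 0 →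
      p = (0, 0) ∨ p = (1, 0) := by
    rintro ⟨a, b⟩ hp hne
    have hx_nonneg := not_lt.mp (mt ibinom_eq_zero_of_neg hne)
    have hx_le := not_lt.mp (mt ibinom_eq_zero_of_lt hne)
    simp only at hx_nonneg hx_le
    have hb_le : b < 1 := by
      by_contra! hb
      rcases hp with h | h <;> simp only at h
      · obtain rfl : a = b := by omega
        nlinarith
      · obtain rfl : a = b + 1 := by omega
        nlinarith
    have hb_ge : -1 < b := by
      by_contra! hb
      rcases hp with h | h <;> simp only at h
      · obtain rfl : a = b := by omega
        nlinarith
      · obtain rfl : a = b + 1 := by omega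
        nlinarith
    rcases hp with h | h <;> simp only at h <;> simp only [Prod.mk.injEq] <;> omega
  have hsum := finsum_mem_eq_sum_of_inter_support_eq (s := Tset) (t := {(0, 0), (1, 0)})
    (fun p : ℤ × ℤ => (-1 : ℤ) ^ (p.1 + p.2).natAbs *
      ibinom (m + n - t - 2) (m - 2 + p.1 * (k - m) + p.2 * (l - n))) (by
    ext p
    simp only [Set.mem_inter_iff, Finset.coe_insert, Finset.coe_singleton, Set.mem_insert_iff,
      Set.mem_singleton_iff, and_congr_left_iff]
    intro hp
    refine ⟨fun hT => key p hT (right_ne_zero_of_mul hp), ?_⟩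
    rintro (rfl | rfl) <;> simp [Tset])
  rw [hsum, Finset.sum_pair (by simp)]
  have hx : m - 2 + (k - m) = k - 2 := by ring
  simp [hx, ← sub_eq_add_neg]
end

section
/- Let m be a positive integer and let F_i denote the i-th Fibonacci number (F_1 = F_2 = 1, F_{i+2} = F_{i+1} + F_i). Then F_{2m} = Σ_{(i,j)∈T} (−1)^{i+j} C(2m−1, m−3i−2j). -/
theorem ibinom_natCast_succ (N : ℕ) (x : ℤ) :
    ibinom ((N + 1 : ℕ) : ℤ) x = ibinom N x + ibinom N (x - 1) := by
  unfold ibinom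
  rcases lt_trichotomy x 0 with h | rfl | h
  · simp [not_le.mpr h, show ¬ (1 : ℤ) ≤ x by omega]
  · simp
    omega
  · obtain ⟨k, rfl⟩ : ∃ k : ℕ, x = k + 1 := ⟨(x - 1).toNat, by omega⟩
    have h1 : ((k : ℤ) + 1).toNat = k + 1 := by omega
    rw [if_pos (by omega), if_pos (by omega), if_pos (by omega), Int.toNat_natCast,
      Int.toNat_natCast, h1, add_sub_cancel_right, Int.toNat_natCast, Nat.choose_succ_succ]
    push_cast
    ring

theorem ibinom_eq_zero_of_not_mem {N : ℕ} {x : ℤ} (h : ¬ (0 ≤ x ∧ x ≤ N)) :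
    ibinom N x = 0 := by
  unfold ibinom
  split_ifs with h'
  · rw [Int.toNat_natCast, Nat.choose_eq_zero_of_lt (by omega), Nat.cast_zero]
  · rfl

/-- The sum of the binomial coefficients `C(N, y)` over `y ≡ x` modulo `5`. -/
noncomputable def binomSumModFive (N : ℕ) (x : ℤ) : ℤ := ∑ᶠ j : ℤ, ibinom N (x - 5 * j)

theorem finite_support_ibinom_sub (N : ℕ) (x : ℤ) :
    (Function.support fun j : ℤ => ibinom N (x - 5 * j)).Finite := by
  refine (Set.finite_Icc (-|x| - N) (|x| + N)).subset fun j hj => ?_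
  have h : 0 ≤ x - 5 * j ∧ x - 5 * j ≤ N := by
    by_contra h
    exact hj (ibinom_eq_zero_of_not_mem h)
  have h1 := le_abs_self x
  have h2 := neg_abs_le x
  constructor <;> omega

theorem binomSumModFive_succ (N : ℕ) (x : ℤ) :
    binomSumModFive (N + 1) x = binomSumModFive N x + binomSumModFive N (x - 1) := by
  unfold binomSumModFive
  rw [← finsum_add_distrib (finite_support_ibinom_sub N x) (finite_support_ibinom_sub N (x - 1))]
  refine finsum_congr fun j => ?_
  rw [ibinom_natCast_succ, sub_right_comm]

theorem binomSumModFive_sub_five (N : ℕ) (x : ℤ) :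
    binomSumModFive N (x - 5) = binomSumModFive N x := by
  unfold binomSumModFive
  rw [← finsum_comp_equiv (Equiv.addRight (1 : ℤ)) (f := fun j => ibinom N (x - 5 * j))]
  refine finsum_congr fun j => ?_
  rw [Equiv.coe_addRight]
  ring_nf

theorem binomSumModFive_zero_zero : binomSumModFive 0 0 = 1 := by
  unfold binomSumModFive
  rw [finsum_eq_single _ 0 fun j hj => ibinom_eq_zero_of_not_mem (by omega)]
  simp [ibinom]

theorem binomSumModFive_zero_of_not_dvd {x : ℤ} (hx : ¬ 5 ∣ x) : binomSumModFive 0 x = 0 := by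
  unfold binomSumModFive
  exact finsum_eq_zero_of_forall_eq_zero fun j => ibinom_eq_zero_of_not_mem (by omega)

/-- The symmetry `C(N, y) = C(N, N - y)` and the Fibonacci values, in a form closed under
induction on `n`. -/
theorem binomSumModFive_odd (n : ℕ) :
    binomSumModFive (2 * n + 1) n = binomSumModFive (2 * n + 1) (n + 1) ∧
    binomSumModFive (2 * n + 1) (n - 1) = binomSumModFive (2 * n + 1) (n + 2) ∧
    (Nat.fib (2 * n + 2) : ℤ) =
      binomSumModFive (2 * n + 1) (n + 1) - binomSumModFive (2 * n + 1) (n - 2) ∧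
    (Nat.fib (2 * n + 3) : ℤ) = 2 * binomSumModFive (2 * n + 1) (n + 1) -
      binomSumModFive (2 * n + 1) (n + 2) - binomSumModFive (2 * n + 1) (n - 2) := by
  induction n with
  | zero =>
    have h1 : binomSumModFive 0 1 = 0 := binomSumModFive_zero_of_not_dvd (by decide)
    have h2 : binomSumModFive 0 2 = 0 := binomSumModFive_zero_of_not_dvd (by decide)
    have h3 : binomSumModFive 0 (-1) = 0 := binomSumModFive_zero_of_not_dvd (by decide)
    have h4 : binomSumModFive 0 (-2) = 0 := binomSumModFive_zero_of_not_dvd (by decide)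
    have h5 : binomSumModFive 0 (-3) = 0 := binomSumModFive_zero_of_not_dvd (by decide)
    norm_num [binomSumModFive_succ, binomSumModFive_zero_zero, h1, h2, h3, h4, h5, Nat.fib_add_two]
  | succ n ih =>
    obtain ⟨h1, h2, h3, h4⟩ := ih
    have step (x : ℤ) : binomSumModFive (2 * (n + 1) + 1) x =
        binomSumModFive (2 * n + 1) x + 2 * binomSumModFive (2 * n + 1) (x - 1) +
          binomSumModFive (2 * n + 1) (x - 2) := by
      rw [show 2 * (n + 1) + 1 = 2 * n + 1 + 1 + 1 by ring, binomSumModFive_succ,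
        binomSumModFive_succ (2 * n + 1) x, binomSumModFive_succ (2 * n + 1) (x - 1), show x - 1 - 1 = x - 2 by ring]
      ring
    have p1 := binomSumModFive_sub_five (2 * n + 1) (n + 3)
    have p2 := binomSumModFive_sub_five (2 * n + 1) (n + 2)
    have f1 : Nat.fib (2 * (n + 1) + 2) = Nat.fib (2 * n + 2) + Nat.fib (2 * n + 3) :=
      Nat.fib_add_two
    have f2 : Nat.fib (2 * (n + 1) + 3) = Nat.fib (2 * n + 3) + Nat.fib (2 * (n + 1) + 2) :=
      Nat.fib_add_two
    rw [f2, f1]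
    push_cast
    simp only [step]
    ring_nf at *
    refine ⟨?_, ?_, ?_, ?_⟩ <;> linarith

theorem finsum_mem_Tset (f : ℤ × ℤ → ℤ)
    (h₀ : (Function.support fun j => f (j, j)).Finite)
    (h₁ : (Function.support fun j => f (j + 1, j)).Finite) :
    ∑ᶠ p ∈ Tset, f p = ∑ᶠ j, f (j, j) + ∑ᶠ j, f (j + 1, j) := by
  have hT : Tset = Set.range (fun j : ℤ => (j, j)) ∪ Set.range (fun j : ℤ => (j + 1, j)) := by
    ext ⟨a, b⟩
    simp only [Tset, Set.mem_ofPred_eq, Set.mem_union, Set.mem_range, Prod.mk.injEq]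
    constructor
    · rintro (h | h)
      · exact Or.inl ⟨b, by omega, rfl⟩
      · exact Or.inr ⟨b, by omega, rfl⟩
    · rintro (⟨j, rfl, rfl⟩ | ⟨j, rfl, rfl⟩) <;> omega
  have hd : Disjoint (Set.range (fun j : ℤ => (j, j))) (Set.range (fun j : ℤ => (j + 1, j))) := by
    rw [Set.disjoint_left]
    rintro _ ⟨j, rfl⟩ ⟨k, hk⟩
    simp only [Prod.mk.injEq] at hk
    omega
  have hfin (g : ℤ → ℤ × ℤ) (h : (Function.support fun j => f (g j)).Finite) :
      (Set.range g ∩ Function.support f).Finite := by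
    refine (h.image g).subset ?_
    rintro _ ⟨⟨j, rfl⟩, hj⟩
    exact ⟨j, hj, rfl⟩
  rw [hT, finsum_mem_union' hd (hfin _ h₀) (hfin _ h₁), finsum_mem_range, finsum_mem_range]
  · intro a b h
    exact (Prod.mk.inj h).2
  · intro a b h
    exact (Prod.mk.inj h).2

theorem stmt13 (m : ℕ) (hm : 0 < m) :
    (Nat.fib (2 * m) : ℤ) =
      ∑ᶠ p ∈ Tset, (-1 : ℤ) ^ (p.1 + p.2).natAbs *
        ibinom (2 * (m : ℤ) - 1) ((m : ℤ) - 3 * p.1 - 2 * p.2) := by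
  obtain ⟨n, rfl⟩ : ∃ n, m = n + 1 := ⟨m - 1, by omega⟩
  have hN : 2 * ((n + 1 : ℕ) : ℤ) - 1 = ((2 * n + 1 : ℕ) : ℤ) := by
    push_cast
    ring
  have e₀ (j : ℤ) : (-1 : ℤ) ^ (j + j).natAbs *
      ibinom (2 * ((n + 1 : ℕ) : ℤ) - 1) (((n + 1 : ℕ) : ℤ) - 3 * j - 2 * j) =
      ibinom (2 * n + 1 : ℕ) ((n + 1 : ℤ) - 5 * j) := by
    rw [Even.neg_one_pow (Int.natAbs_even.mpr ⟨j, rfl⟩), hN, one_mul]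
    congr 1
    push_cast
    ring
  have e₁ (j : ℤ) : (-1 : ℤ) ^ (j + 1 + j).natAbs *
      ibinom (2 * ((n + 1 : ℕ) : ℤ) - 1) (((n + 1 : ℕ) : ℤ) - 3 * (j + 1) - 2 * j) =
      -ibinom (2 * n + 1 : ℕ) ((n - 2 : ℤ) - 5 * j) := by
    rw [Odd.neg_one_pow (Int.natAbs_odd.mpr ⟨j, by ring⟩), hN, neg_one_mul]
    congr 2
    push_cast
    ring
  rw [finsum_mem_Tset]
  · simp only [e₀, e₁]
    rw [finsum_neg_distrib, ← sub_eq_add_neg]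
    exact (binomSumModFive_odd n).2.2.1
  · simp only [e₀]
    exact finite_support_ibinom_sub _ _
  · simp only [e₁, Function.support_fun_neg]
    exact finite_support_ibinom_sub _ _
end

section
/- Let m, n, l, k, r be non-negative integers with k ≤ min(m−2, n−2), l ≤ min(m−2, n−2), r ≥ 1 and r < min(m−k, n−l). Let Y = {(i,j) ∈ ℤ×ℤ : 1 ≤ i ≤ m, max(1, l+2−i) ≤ j ≤ min(n, n+m−k−i)} be the two-sided diagonal ladder, and set P_i = (i, n) and Q_i = (m, i) for i = 1, …, r. Then the number of r-tuples of non-intersecting paths in Y from P_1, …, P_r to Q_1, …, Q_r equals det[ Σ_{(a,b)∈T} (−1)^{a+b} C(m+n−i−j, m−1+(a−b−1)(i−1)+a(k−m)+b(l−n)) ]_{i,j=1,…,r}. (By the paper's Theorem 4.1, this number is the multiplicity of the ladder determinantal ring K[Y]/I_{r+1}(Y).) -/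
section Ladder

open Finset

theorem LPath.head? {Y : Set (ℤ × ℤ)} {p Q : ℤ × ℤ} {c : List (ℤ × ℤ)} (h : LPath Y p Q c) :
    c.head? = some p := h.1

theorem LPath.mem_start {Y : Set (ℤ × ℤ)} {p Q : ℤ × ℤ} {c : List (ℤ × ℤ)} (h : LPath Y p Q c) :
    p ∈ c := List.mem_of_head? h.1

theorem LPath.start_mem_s14 {Y : Set (ℤ × ℤ)} {p Q : ℤ × ℤ} {c : List (ℤ × ℤ)} (h : LPath Y p Q c) :
    p ∈ Y := h.2.2.1 p h.mem_start

theorem LPath.end_mem {Y : Set (ℤ × ℤ)} {p Q : ℤ × ℤ} {c : List (ℤ × ℤ)} (h : LPath Y p Q c) :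
    Q ∈ Y := h.2.2.1 Q (List.mem_of_getLast? h.2.1)

theorem lPath_iff {Y : Set (ℤ × ℤ)} {p Q : ℤ × ℤ} {c : List (ℤ × ℤ)} :
    LPath Y p Q c ↔ p ∈ Y ∧ ((p = Q ∧ c = [p]) ∨ ∃ c', c = p :: c' ∧
      (LPath Y (p.1 + 1, p.2) Q c' ∨ LPath Y (p.1, p.2 - 1) Q c')) := by
  unfold LPath
  rcases c with _ | ⟨a, _ | ⟨b, c⟩⟩
  · simp
  · simp only [List.Chain']
    constructor
    · rintro ⟨h1, h2, h3, -⟩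
      simp at h1 h2 h3
      subst h1
      exact ⟨h3, Or.inl ⟨h2, rfl⟩⟩
    · rintro ⟨h, ⟨rfl, h2⟩ | ⟨c', h2, h3⟩⟩
      · simp_all
      · simp at h2
        obtain ⟨-, rfl⟩ := h2
        simp at h3
  · simp only [List.Chain']
    constructor
    · rintro ⟨h1, h2, h3, h4⟩
      simp at h1
      subst h1
      refine ⟨h3 a (by simp), Or.inr ⟨_, rfl, ?_⟩⟩
      rw [List.isChain_cons_cons] at h4
      have h5 : ∀ z ∈ b :: c, z ∈ Y := fun z hz => h3 z (List.mem_cons_of_mem _ hz)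
      have h6 : (b :: c).getLast? = some Q := by rw [List.getLast?_cons_cons] at h2; exact h2
      rcases h4.1 with rfl | rfl
      · exact Or.inl ⟨rfl, h6, h5, h4.2⟩
      · exact Or.inr ⟨rfl, h6, h5, h4.2⟩
    · rintro ⟨h, ⟨rfl, h2⟩ | ⟨c', h2, h3⟩⟩
      · simp at h2
      · simp only [List.cons.injEq] at h2
        obtain ⟨rfl, rfl⟩ := h2
        refine ⟨rfl, ?_, ?_, ?_⟩
        · rw [List.getLast?_cons_cons]; rcases h3 with h3 | h3 <;> exact h3.2.1
        · intro z hz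
          rcases List.mem_cons.1 hz with rfl | hz
          · exact h
          · rcases h3 with h3 | h3 <;> exact h3.2.2.1 z hz
        · rw [List.isChain_cons_cons]
          rcases h3 with h3 | h3
          · refine ⟨Or.inl ?_, h3.2.2.2⟩
            simpa using h3.1
          · refine ⟨Or.inr ?_, h3.2.2.2⟩
            simpa using h3.1

open Classical in
/-- The possible successors of a point in the ladder extended by vertical half-lines above height
`n` (which can only be descended) and horizontal half-lines to the right of abscissa `m` (which
can only be followed to the right). -/
noncomputable def nextPts (m n : ℤ) (Y : Set (ℤ × ℤ)) (p : ℤ × ℤ) : Finset (ℤ × ℤ) :=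
  if m < p.1 then {(p.1 + 1, p.2)}
  else if n < p.2 then {(p.1, p.2 - 1)}
  else if p ∈ Y then {(p.1 + 1, p.2), (p.1, p.2 - 1)} else ∅

/-- The part of the one-point path `[p]` lying outside the added half-lines. -/
def visiblePart (m n : ℤ) (p : ℤ × ℤ) : List (ℤ × ℤ) :=
  if m < p.1 ∨ n < p.2 then [] else [p]

/-- The visible parts of the paths with `t` steps in the extended ladder from `p` to
`(m + j, j)`. -/
noncomputable def tracks (m n : ℤ) (Y : Set (ℤ × ℤ)) : ℕ → ℤ × ℤ → ℤ → Finset (List (ℤ × ℤ))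
  | 0, p, j => if p = (m + j, j) then {[]} else ∅
  | t + 1, p, j => (nextPts m n Y p).biUnion fun q =>
      (tracks m n Y t q j).image (visiblePart m n p ++ ·)

/-- Description of the visible parts of paths ending on the horizontal half-line of height `j`. -/
def IsTrack (m n : ℤ) (Y : Set (ℤ × ℤ)) (p : ℤ × ℤ) (j : ℤ) (c : List (ℤ × ℤ)) : Prop :=
  if m < p.1 then c = [] ∧ p.2 = j
  else if n < p.2 then LPath Y (p.1, n) (m, j) c
  else LPath Y p (m, j) c

variable {m n : ℤ} {Y : Set (ℤ × ℤ)}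

theorem isTrack_iff (hY : ∀ p ∈ Y, 1 ≤ p.1 ∧ p.1 ≤ m ∧ 1 ≤ p.2 ∧ p.2 ≤ n)
    {p : ℤ × ℤ} {j : ℤ} {c : List (ℤ × ℤ)} :
    IsTrack m n Y p j c ↔
      ∃ q ∈ nextPts m n Y p, ∃ c', IsTrack m n Y q j c' ∧ visiblePart m n p ++ c' = c := by
  obtain ⟨x, y⟩ := p
  by_cases h2 : m < x
  · have h3 : m < x + 1 := by omega
    simp [nextPts, visiblePart, IsTrack, h2, h3]
  by_cases h1 : n < y
  · simp only [nextPts, visiblePart, h1, h2, if_true, if_false, or_true, mem_singleton,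
      exists_eq_left, List.nil_append, exists_eq_right]
    unfold IsTrack
    simp only [h1, h2, if_true, if_false]
    by_cases h3 : n < y - 1
    · simp [h3]
    · have h4 : y - 1 = n := by omega
      simp [h4]
  by_cases h3 : (x, y) ∈ Y
  · have h4 : ¬ n < y - 1 := by omega
    simp only [nextPts, visiblePart, IsTrack, h1, h2, h3, h4, if_false, if_true, or_false,
      mem_insert, mem_singleton, exists_eq_or_imp, exists_eq_left]
    rw [lPath_iff]
    simp only [h3, true_and, List.singleton_append]
    by_cases h5 : m < x + 1
    · have h6 : x = m := by omega
      subst h6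
      have h7 : ∀ c', ¬ LPath Y (x + 1, y) (x, j) c' := by
        intro c' h
        have := hY _ h.start_mem_s14
        simp at this
      simp only [h5, if_true, h7, false_or, Prod.mk.injEq, true_and]
      constructor
      · rintro (⟨rfl, rfl⟩ | ⟨c', rfl, h⟩)
        · exact Or.inl ⟨[], by simp⟩
        · exact Or.inr ⟨c', h, rfl⟩
      · rintro (⟨c', ⟨rfl, rfl⟩, rfl⟩ | ⟨c', h, rfl⟩)
        · exact Or.inl (by simp)
        · exact Or.inr ⟨c', rfl, h⟩
    · have h6 : x ≠ m := by omega
      simp only [h5, if_false, Prod.mk.injEq, h6, false_and, false_or]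
      constructor
      · rintro ⟨c', rfl, h | h⟩
        · exact Or.inl ⟨c', h, rfl⟩
        · exact Or.inr ⟨c', h, rfl⟩
      · rintro (⟨c', h, rfl⟩ | ⟨c', h, rfl⟩)
        · exact ⟨c', rfl, Or.inl h⟩
        · exact ⟨c', rfl, Or.inr h⟩
  · simp only [nextPts, IsTrack, h1, h2, h3, if_false]
    constructor
    · intro h
      exact absurd h.start_mem_s14 h3
    · simp

theorem time_of_mem_nextPts {p q : ℤ × ℤ} (h : q ∈ nextPts m n Y p) :
    q.1 - q.2 = p.1 - p.2 + 1 := by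
  unfold nextPts at h
  split_ifs at h <;> simp at h
  · subst h; ring
  · subst h; ring
  · rcases h with rfl | rfl <;> ring

theorem fst_of_mem_nextPts {p q : ℤ × ℤ} (h : q ∈ nextPts m n Y p) :
    p.1 ≤ q.1 ∧ q.1 ≤ p.1 + 1 := by
  unfold nextPts at h
  split_ifs at h <;> simp at h
  · subst h; simp
  · subst h; simp
  · rcases h with rfl | rfl <;> simp

theorem mem_tracks_iff (hY : ∀ p ∈ Y, 1 ≤ p.1 ∧ p.1 ≤ m ∧ 1 ≤ p.2 ∧ p.2 ≤ n)
    {j : ℤ} (hj : 1 ≤ j) {t : ℕ} {p : ℤ × ℤ} (hp : p.1 - p.2 + t = m)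
    {c : List (ℤ × ℤ)} : c ∈ tracks m n Y t p j ↔ IsTrack m n Y p j c := by
  induction t generalizing p c with
  | zero =>
    obtain ⟨x, y⟩ := p
    simp only [Nat.cast_zero, add_zero] at hp
    have hx : x = m + y := by omega
    subst hx
    simp only [tracks, IsTrack, Prod.mk.injEq, add_right_inj, and_self]
    split_ifs with h1 h2 h3 h4 h5
    · simp [h1]
    · omega
    · omega
    · simp [h1]
    · simp only [notMem_empty, false_iff]
      intro h
      have := hY _ h.start_mem_s14
      simp at this
      omega
    · simp only [notMem_empty, false_iff]
      intro h
      have := hY _ h.start_mem_s14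
      simp at this
      omega
  | succ t ih =>
    rw [isTrack_iff hY]
    simp only [tracks, mem_biUnion, mem_image]
    refine exists_congr fun q => and_congr_right fun hq => exists_congr fun c' => ?_
    rw [ih]
    have := time_of_mem_nextPts hq
    push_cast at hp
    omega

theorem time_le_of_mem_tracks {j : ℤ} {t : ℕ} {p : ℤ × ℤ} {c : List (ℤ × ℤ)}
    (hc : c ∈ tracks m n Y t p j) : ∀ z ∈ c, p.1 - p.2 ≤ z.1 - z.2 := by
  induction t generalizing p c with
  | zero =>
    simp only [tracks] at hc
    split_ifs at hc
    · simp at hc; subst hc; simp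
    · simp at hc
  | succ t ih =>
    simp only [tracks, mem_biUnion, mem_image] at hc
    obtain ⟨q, hq, c', hc', rfl⟩ := hc
    intro z hz
    rcases List.mem_append.1 hz with hz | hz
    · unfold visiblePart at hz
      split_ifs at hz <;> simp at hz
      rw [hz]
    · have := ih hc' z hz
      have := time_of_mem_nextPts hq
      omega

theorem nextPts_unique (hY : ∀ p ∈ Y, 1 ≤ p.1 ∧ p.1 ≤ m ∧ 1 ≤ p.2 ∧ p.2 ≤ n)
    {p q q' : ℤ × ℤ} {j : ℤ} {c : List (ℤ × ℤ)}
    (hq : q ∈ nextPts m n Y p) (hq' : q' ∈ nextPts m n Y p)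
    (hc : IsTrack m n Y q j c) (hc' : IsTrack m n Y q' j c) : q = q' := by
  have key : ∀ x y, (x, y) ∈ Y → IsTrack m n Y (x + 1, y) j c →
      ¬ IsTrack m n Y (x, y - 1) j c := by
    intro x y hxy h1 h2
    have := hY _ hxy
    simp only at this
    have e1 : ¬ m < x := by omega
    have e2 : ¬ n < y - 1 := by omega
    have e3 : ¬ n < y := by omega
    simp only [IsTrack, e1, e2, e3, if_false] at h1 h2
    split_ifs at h1
    · have := h2.mem_start
      simp [h1.1] at this
    · have := h1.head?.symm.trans h2.head?
      simp at this
  unfold nextPts at hq hq'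
  split_ifs at hq hq' with h1 h2 h3
  · simp at hq hq'; rw [hq, hq']
  · simp at hq hq'; rw [hq, hq']
  · simp only [mem_insert, mem_singleton] at hq hq'
    rcases hq with rfl | rfl <;> rcases hq' with rfl | rfl
    · rfl
    · exact absurd hc' (key _ _ h3 hc)
    · exact absurd hc (key _ _ h3 hc')
    · rfl
  · simp at hq

open Classical in
/-- Families of pairwise disjoint tracks. -/
noncomputable def disjointTracks (m n : ℤ) (Y : Set (ℤ × ℤ)) (t : ℕ) {r : ℕ}
    (x : Fin r → ℤ × ℤ) (j : Fin r → ℤ) : Finset (Fin r → List (ℤ × ℤ)) :=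
  {C ∈ Fintype.piFinset fun i => tracks m n Y t (x i) (j i) |
    ∀ i i', i ≠ i' → ∀ p ∈ C i, p ∉ C i'}

theorem mem_disjointTracks {t r : ℕ} {x : Fin r → ℤ × ℤ} {j : Fin r → ℤ}
    {C : Fin r → List (ℤ × ℤ)} : C ∈ disjointTracks m n Y t x j ↔
      (∀ i, C i ∈ tracks m n Y t (x i) (j i)) ∧ ∀ i i', i ≠ i' → ∀ p ∈ C i, p ∉ C i' := by
  simp [disjointTracks]

theorem card_tracks_succ (hY : ∀ p ∈ Y, 1 ≤ p.1 ∧ p.1 ≤ m ∧ 1 ≤ p.2 ∧ p.2 ≤ n)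
    {j : ℤ} (hj : 1 ≤ j) {t : ℕ} {p : ℤ × ℤ} (hp : p.1 - p.2 + (t + 1 : ℕ) = m) :
    #(tracks m n Y (t + 1) p j) = ∑ q ∈ nextPts m n Y p, #(tracks m n Y t q j) := by
  rw [tracks, card_biUnion]
  · exact sum_congr rfl fun q _ => card_image_of_injective _ (List.append_right_injective _)
  · intro q hq q' hq' hne
    rw [Function.onFun, Finset.disjoint_left]
    intro c hc hc'
    simp only [mem_image] at hc hc'
    obtain ⟨d, hd, rfl⟩ := hc
    obtain ⟨d', hd', he⟩ := hc'
    obtain rfl := List.append_cancel_left he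
    have e := time_of_mem_nextPts hq
    have e' := time_of_mem_nextPts hq'
    push_cast at hp
    exact hne (nextPts_unique hY hq hq' ((mem_tracks_iff hY hj (by omega)).1 hd)
      ((mem_tracks_iff hY hj (by omega)).1 hd'))

theorem card_disjointTracks_succ (hY : ∀ p ∈ Y, 1 ≤ p.1 ∧ p.1 ≤ m ∧ 1 ≤ p.2 ∧ p.2 ≤ n)
    {t r : ℕ} {x : Fin r → ℤ × ℤ} {j : Fin r → ℤ} (hj : ∀ i, 1 ≤ j i)
    (hx : Function.Injective x) (hp : ∀ i, (x i).1 - (x i).2 + (t + 1 : ℕ) = m) :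
    #(disjointTracks m n Y (t + 1) x j) =
      ∑ y ∈ Fintype.piFinset fun i => nextPts m n Y (x i), #(disjointTracks m n Y t y j) := by
  have hU : disjointTracks m n Y (t + 1) x j =
      (Fintype.piFinset fun i => nextPts m n Y (x i)).biUnion fun y =>
        (disjointTracks m n Y t y j).image fun C i => visiblePart m n (x i) ++ C i := by
    ext C
    simp only [mem_disjointTracks, mem_biUnion, mem_image, Fintype.mem_piFinset, tracks]
    constructor
    · rintro ⟨h1, h2⟩
      choose y hy D hD hC using h1
      refine ⟨y, hy, D, ⟨hD, ?_⟩, funext hC⟩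
      intro i i' hi p hp hp'
      refine h2 i i' hi p ?_ ?_
      · rw [← hC]; exact List.mem_append_right _ hp
      · rw [← hC]; exact List.mem_append_right _ hp'
    · rintro ⟨y, hy, D, ⟨hD, hdis⟩, rfl⟩
      refine ⟨fun i => ⟨y i, hy i, D i, hD i, rfl⟩, ?_⟩
      have hv : ∀ i, ∀ p ∈ visiblePart m n (x i), p = x i := by
        intro i p h
        unfold visiblePart at h
        split_ifs at h <;> simp at h
        exact h
      have ht : ∀ i i', x i' ∉ D i := by
        intro i i' h
        have e1 := time_le_of_mem_tracks (hD i) _ h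
        have e2 := time_of_mem_nextPts (hy i)
        have e3 := hp i
        have e4 := hp i'
        omega
      intro i i' hi p h h'
      rcases List.mem_append.1 h with h | h <;> rcases List.mem_append.1 h' with h' | h'
      · exact hi (hx ((hv _ _ h).symm.trans (hv _ _ h')))
      · rw [hv _ _ h] at h'
        exact ht _ _ h'
      · rw [hv _ _ h'] at h
        exact ht _ _ h
      · exact hdis i i' hi p h h'
  rw [hU, card_biUnion]
  · refine sum_congr rfl fun y _ => card_image_of_injective _ fun C C' h => ?_
    funext i
    exact List.append_cancel_left (congrFun h i)
  · intro y hy y' hy' hne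
    rw [Function.onFun, Finset.disjoint_left]
    intro c hc hc'
    simp only [mem_image, mem_disjointTracks] at hc hc'
    obtain ⟨d, hd, rfl⟩ := hc
    obtain ⟨d', hd', he⟩ := hc'
    refine hne (funext fun i => ?_)
    have hi := List.append_cancel_left (congrFun he i)
    have hyi := Fintype.mem_piFinset.1 hy i
    have hyi' := Fintype.mem_piFinset.1 hy' i
    have e := time_of_mem_nextPts hyi
    have e' := time_of_mem_nextPts hyi'
    have hpi := hp i
    push_cast at hpi
    refine nextPts_unique hY hyi hyi' ((mem_tracks_iff hY (hj i) (by omega)).1 (hd.1 i)) ?_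
    rw [← hi]
    exact (mem_tracks_iff hY (hj i) (by omega)).1 (hd'.1 i)

theorem disjointTracks_eq_empty (hY : ∀ p ∈ Y, 1 ≤ p.1 ∧ p.1 ≤ m ∧ 1 ≤ p.2 ∧ p.2 ≤ n)
    {t r : ℕ} {x : Fin r → ℤ × ℤ} {j : Fin r → ℤ} (hj : ∀ i, 1 ≤ j i)
    (hji : Function.Injective j) (hx : ¬ Function.Injective x)
    (hp : ∀ i, (x i).1 - (x i).2 + t = m) : disjointTracks m n Y t x j = ∅ := by
  rw [eq_empty_iff_forall_notMem]
  intro C hC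
  rw [mem_disjointTracks] at hC
  obtain ⟨h1, h2⟩ := hC
  simp only [Function.Injective, not_forall] at hx
  obtain ⟨i, i', hi, hne⟩ := hx
  have e1 := (mem_tracks_iff hY (hj i) (hp i)).1 (h1 i)
  have e2 := (mem_tracks_iff hY (hj i') (hp i')).1 (h1 i')
  rw [← hi] at e2
  unfold IsTrack at e1 e2
  split_ifs at e1 e2
  · exact hne (hji (e1.2.symm.trans e2.2))
  · exact h2 i i' hne _ e1.mem_start e2.mem_start
  · exact h2 i i' hne _ e1.mem_start e2.mem_start

theorem det_indicator_eq {r : ℕ} {α : Type*} [DecidableEq α] {x q : Fin r → α} {f : α → ℤ}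
    (hx : StrictMono (f ∘ x)) (hq : StrictMono (f ∘ q)) :
    Matrix.det (Matrix.of fun i j => if x i = q j then (1 : ℤ) else 0) =
      if x = q then 1 else 0 := by
  have hqi : Function.Injective q := hq.injective.of_comp
  split_ifs with h
  · subst h
    convert Matrix.det_one (n := Fin r) (R := ℤ) using 2
    ext i j
    simp [Matrix.one_apply, hqi.eq_iff]
  · by_contra hne
    have hrow : ∀ i, ∃ j, x i = q j := by
      intro i
      by_contra! hi
      exact hne (Matrix.det_eq_zero_of_row_eq_zero i fun j => by simp [hi j])
    choose g hg using hrow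
    have hmono : StrictMono g := by
      intro a b hab
      have := hx hab
      simp only [Function.comp, hg] at this
      exact hq.lt_iff_lt.1 this
    have hid : g = id := by
      apply (StrictMono.range_inj hmono strictMono_id).1
      rw [(Finite.injective_iff_surjective.1 hmono.injective).range_eq]
      simp
    exact h (funext fun i => by rw [hg i, hid]; rfl)

theorem card_disjointTracks_eq_det (hY : ∀ p ∈ Y, 1 ≤ p.1 ∧ p.1 ≤ m ∧ 1 ≤ p.2 ∧ p.2 ≤ n)
    {t r : ℕ} {x : Fin r → ℤ × ℤ} {j : Fin r → ℤ} (hj : ∀ i, 1 ≤ j i) (hjm : StrictMono j)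
    (hx : StrictMono fun i => (x i).1) (hp : ∀ i, (x i).1 - (x i).2 + t = m) :
    (#(disjointTracks m n Y t x j) : ℤ) =
      Matrix.det (Matrix.of fun i i' => (#(tracks m n Y t (x i) (j i')) : ℤ)) := by
  induction t generalizing x with
  | zero =>
    have h1 : ∀ i i', (#(tracks m n Y 0 (x i) (j i')) : ℤ) =
        if x i = (fun a => (m + j a, j a)) i' then 1 else 0 := by
      intro i i'
      simp only [tracks]
      split_ifs <;> simp
    simp only [h1]
    rw [det_indicator_eq (f := Prod.fst) hx (by intro a b hab; simpa using hjm hab)]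
    split_ifs with h
    · have : disjointTracks m n Y 0 x j = {fun _ => []} := by
        ext C
        simp only [mem_disjointTracks, mem_singleton, tracks, h, if_true]
        constructor
        · rintro ⟨h, -⟩
          exact funext h
        · rintro rfl
          simp
      simp [this]
    · have : disjointTracks m n Y 0 x j = ∅ := by
        rw [eq_empty_iff_forall_notMem]
        intro C hC
        rw [mem_disjointTracks] at hC
        apply h
        funext i
        have := hC.1 i
        by_contra hne
        simp [tracks, hne] at this
      simp [this]
  | succ t ih =>
    have hxi : Function.Injective x := fun a b h => hx.injective (congrArg Prod.fst h)
    rw [card_disjointTracks_succ hY hj hxi hp]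
    have h1 : ∀ i i', (#(tracks m n Y (t + 1) (x i) (j i')) : ℤ) =
        (∑ q ∈ nextPts m n Y (x i), fun a => (#(tracks m n Y t q (j a)) : ℤ)) i' := by
      intro i i'
      rw [card_tracks_succ hY (hj i') (hp i), Finset.sum_apply]
      push_cast
      rfl
    simp only [h1]
    have h2 := (Matrix.detRowAlternating (n := Fin r) (R := ℤ)).toMultilinearMap.map_sum_finset
      (fun _ q a => (#(tracks m n Y t q (j a)) : ℤ)) (fun i => nextPts m n Y (x i))
    refine Eq.trans ?_ h2.symm
    push_cast
    refine sum_congr rfl fun y hy => ?_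
    have hy' := fun i => Fintype.mem_piFinset.1 hy i
    have hpy : ∀ i, (y i).1 - (y i).2 + t = m := by
      intro i
      have e1 := time_of_mem_nextPts (hy' i)
      have e2 := hp i
      push_cast at e2
      omega
    by_cases hinj : Function.Injective y
    · have hmono : StrictMono fun i => (y i).1 := by
        apply Monotone.strictMono_of_injective
        · intro a b hab
          rcases hab.eq_or_lt with rfl | hab
          · exact le_rfl
          · have e1 := hx hab
            have e2 := fst_of_mem_nextPts (hy' a)
            have e3 := fst_of_mem_nextPts (hy' b)
            simp only at e1 ⊢
            omega
        · intro a b hab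
          apply hinj
          have e1 := hpy a
          have e2 := hpy b
          simp only at hab
          exact Prod.ext hab (by omega)
      exact ih hmono hpy
    · rw [disjointTracks_eq_empty hY hj hjm.injective hinj hpy]
      simp only [Function.Injective, not_forall] at hinj
      obtain ⟨a, b, hab, hne⟩ := hinj
      refine Eq.symm ?_
      refine (Matrix.det_zero_of_row_eq hne ?_).trans (by simp)
      simp [hab]

theorem ibinom_of_neg_left {N x : ℤ} (h : N < 0) : ibinom N x = 0 := by
  unfold ibinom
  rw [if_neg (by omega)]

theorem ibinom_eq_zero {N x : ℤ} (h : x < 0 ∨ N < x) : ibinom N x = 0 := by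
  unfold ibinom
  split_ifs with h1
  · rw [Nat.choose_eq_zero_of_lt (by omega)]
    rfl
  · rfl

theorem ibinom_zero_left (x : ℤ) : ibinom 0 x = if x = 0 then 1 else 0 := by
  split_ifs with h
  · subst h; rfl
  · exact ibinom_eq_zero (by omega)

theorem ibinom_pascal {N : ℤ} (hN : 1 ≤ N) (x : ℤ) :
    ibinom N x = ibinom (N - 1) x + ibinom (N - 1) (x - 1) := by
  obtain ⟨N, rfl⟩ : ∃ N' : ℕ, N = N' + 1 := ⟨(N - 1).toNat, by omega⟩
  simp only [add_sub_cancel_right]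
  rcases lt_trichotomy x 0 with hx | rfl | hx
  · rw [ibinom_eq_zero (Or.inl hx), ibinom_eq_zero (Or.inl hx), ibinom_eq_zero (by omega)]
    rfl
  · rw [ibinom_eq_zero (x := 0 - 1) (by omega)]
    simp [ibinom]
    omega
  · obtain ⟨y, rfl⟩ : ∃ y : ℕ, x = y + 1 := ⟨(x - 1).toNat, by omega⟩
    have e : ((N : ℤ) + 1).toNat = N + 1 := by omega
    have e' : ((y : ℤ) + 1).toNat = y + 1 := by omega
    simp only [ibinom, add_sub_cancel_right]
    rw [if_pos (by omega), if_pos (by omega), if_pos (by omega), e, e', Int.toNat_natCast,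
      Int.toNat_natCast, Nat.choose_succ_succ]
    push_cast
    ring

/-- The sum of the binomial coefficients `C(N, y)` over `y` congruent to `x` modulo `M`. -/
noncomputable def periodicBinom (M N x : ℤ) : ℤ := ∑ᶠ a : ℤ, ibinom N (x - a * M)

theorem finite_support_ibinom {M : ℤ} (hM : 0 < M) (N x : ℤ) :
    (Function.support fun a : ℤ => ibinom N (x - a * M)).Finite := by
  refine (Set.finite_Icc (-(|x| + |N|)) (|x| + |N|)).subset fun a ha => ?_
  rw [Function.mem_support] at ha
  have h1 : 0 ≤ x - a * M ∧ x - a * M ≤ N := by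
    by_contra h
    exact ha (ibinom_eq_zero (by omega))
  have h2 := le_abs_self x
  have h3 := neg_abs_le x
  have h4 := le_abs_self N
  rw [Set.mem_Icc]
  constructor
  · by_contra h
    nlinarith
  · by_contra h
    nlinarith [abs_nonneg N]

theorem periodicBinom_add_period (M N x : ℤ) :
    periodicBinom M N (x + M) = periodicBinom M N x := by
  unfold periodicBinom
  rw [← finsum_comp_equiv (Equiv.addRight (1 : ℤ))]
  refine finsum_congr fun a => ?_
  simp only [Equiv.coe_addRight]
  congr 1
  ring

theorem periodicBinom_pascal {M N : ℤ} (hM : 0 < M) (hN : 1 ≤ N) (x : ℤ) :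
    periodicBinom M N x = periodicBinom M (N - 1) x + periodicBinom M (N - 1) (x - 1) := by
  unfold periodicBinom
  rw [← finsum_add_distrib (finite_support_ibinom hM _ _) (finite_support_ibinom hM _ _)]
  refine finsum_congr fun a => ?_
  rw [ibinom_pascal hN]
  congr 2
  ring

theorem periodicBinom_of_neg {M N : ℤ} (hN : N < 0) (x : ℤ) : periodicBinom M N x = 0 := by
  simp [periodicBinom, ibinom_of_neg_left hN]

theorem periodicBinom_zero {M : ℤ} (hM : 0 < M) (x : ℤ) :
    periodicBinom M 0 x = if M ∣ x then 1 else 0 := by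
  unfold periodicBinom
  simp only [ibinom_zero_left]
  split_ifs with h
  · obtain ⟨c, rfl⟩ := h
    rw [finsum_eq_single _ c]
    · simp [mul_comm]
    · intro a ha
      rw [if_neg]
      intro h
      apply ha
      have : M * (c - a) = 0 := by linarith
      rcases mul_eq_zero.1 this with h | h <;> omega
  · refine finsum_eq_zero_of_forall_eq_zero fun a => ?_
    rw [if_neg]
    intro ha
    exact h ⟨a, by linarith⟩

/-- The reflection formula for the number of paths from `p` to `(m, j)` staying in the strip
`l + 1 < p.1 + p.2 < l + 1 + M`. -/
noncomputable def stripCount (l M m j : ℤ) (p : ℤ × ℤ) : ℤ :=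
  periodicBinom M (m - p.1 + p.2 - j) (m - p.1) -
    periodicBinom M (m - p.1 + p.2 - j) (m - l - 1 + p.2)

theorem stripCount_boundary {l M m j : ℤ} {p : ℤ × ℤ}
    (h : p.1 + p.2 = l + 1 ∨ p.1 + p.2 = l + 1 + M) : stripCount l M m j p = 0 := by
  unfold stripCount
  rcases h with h | h
  · rw [show m - l - 1 + p.2 = m - p.1 by linarith, sub_self]
  · rw [show m - l - 1 + p.2 = m - p.1 + M by linarith, periodicBinom_add_period, sub_self]

theorem stripCount_of_neg {l M m j : ℤ} {p : ℤ × ℤ} (h : m - p.1 + p.2 - j < 0) :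
    stripCount l M m j p = 0 := by
  unfold stripCount
  rw [periodicBinom_of_neg h, periodicBinom_of_neg h, sub_self]

theorem stripCount_rec {l M m j : ℤ} (hM : 0 < M) (hj : l + 1 ≤ m + j) (hj' : m + j ≤ l + 1 + M)
    {x y : ℤ} (h : l + 1 < x + y) (h' : x + y < l + 1 + M) :
    stripCount l M m j (x, y) = stripCount l M m j (x + 1, y) + stripCount l M m j (x, y - 1) +
      if (x, y) = (m, j) then 1 else 0 := by
  rcases lt_trichotomy (m - x + y - j) 0 with hN | hN | hN
  · rw [stripCount_of_neg (p := (x, y)) hN,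
      stripCount_of_neg (p := (x + 1, y)) (by simp only; omega),
      stripCount_of_neg (p := (x, y - 1)) (by simp only; omega), if_neg]
    · simp
    · simp only [Prod.mk.injEq]
      omega
  · rw [stripCount_of_neg (p := (x + 1, y)) (by simp only; omega),
      stripCount_of_neg (p := (x, y - 1)) (by simp only; omega)]
    simp only [stripCount, hN]
    rw [periodicBinom_zero hM, periodicBinom_zero hM]
    have h1 : ¬ M ∣ m - l - 1 + y := by
      rintro ⟨c, hc⟩
      have h2 : 0 < c := by
        by_contra hc'
        nlinarith
      have h3 : c < 1 := by
        by_contra hc'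
        nlinarith
      omega
    have h2 : M ∣ m - x ↔ (x, y) = (m, j) := by
      constructor
      · rintro ⟨c, hc⟩
        have h2 : -1 < c := by
          by_contra hc'
          nlinarith
        have h3 : c < 1 := by
          by_contra hc'
          nlinarith
        have : c = 0 := by omega
        subst this
        simp only [Prod.mk.injEq]
        omega
      · simp only [Prod.mk.injEq]
        rintro ⟨rfl, rfl⟩
        simp
    simp [h1, h2]
  · rw [if_neg (by simp only [Prod.mk.injEq]; omega)]
    simp only [stripCount]
    rw [periodicBinom_pascal hM (by omega) (m - x),
      periodicBinom_pascal hM (by omega) (m - l - 1 + y),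
      show m - (x + 1) + y - j = m - x + y - j - 1 by ring,
      show m - x + (y - 1) - j = m - x + y - j - 1 by ring,
      show m - (x + 1) = m - x - 1 by ring,
      show m - l - 1 + (y - 1) = m - l - 1 + y - 1 by ring]
    ring

theorem stripCount_of_unreachable {l M m j : ℤ} (hM : 0 < M) (hj : l + 1 ≤ m + j)
    (hj' : m + j ≤ l + 1 + M) {x y : ℤ} (h : l + 1 ≤ x + y) (h' : x + y ≤ l + 1 + M)
    (hxy : m < x ∨ y < j) : stripCount l M m j (x, y) = 0 := by
  obtain ⟨N, hN⟩ : ∃ N : ℕ, m - x + y - j < N :=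
    ⟨(m - x + y - j + 1).toNat, by omega⟩
  induction N generalizing x y with
  | zero => exact stripCount_of_neg (by simpa using hN)
  | succ N ih =>
    push_cast at hN
    by_cases hb : x + y = l + 1 ∨ x + y = l + 1 + M
    · exact stripCount_boundary hb
    · rw [stripCount_rec hM hj hj' (by omega) (by omega), ih (by omega) (by omega) (by omega)
        (by omega), ih (by omega) (by omega) (by omega) (by omega), if_neg]
      · simp
      · simp only [Prod.mk.injEq]
        omega

theorem card_tracks_of_lt (hY : ∀ p ∈ Y, 1 ≤ p.1 ∧ p.1 ≤ m ∧ 1 ≤ p.2 ∧ p.2 ≤ n)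
    {j : ℤ} (hj : 1 ≤ j) {t : ℕ} {p : ℤ × ℤ} (hp : p.1 - p.2 + t = m) (h : m < p.1) :
    #(tracks m n Y t p j) = if p.2 = j then 1 else 0 := by
  have h1 : ∀ c, c ∈ tracks m n Y t p j ↔ c = [] ∧ p.2 = j := by
    intro c
    rw [mem_tracks_iff hY hj hp, IsTrack, if_pos h]
  split_ifs with h2
  · rw [card_eq_one]
    exact ⟨[], by ext c; simp [h1, h2]⟩
  · rw [card_eq_zero, eq_empty_iff_forall_notMem]
    intro c hc
    exact h2 ((h1 c).1 hc).2

theorem card_tracks_eq_stripCount {l M : ℤ} (hM : 0 < M)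
    (hYm : ∀ p : ℤ × ℤ, p ∈ Y ↔ (1 ≤ p.1 ∧ p.1 ≤ m) ∧ (1 ≤ p.2 ∧ p.2 ≤ n) ∧
      l + 1 < p.1 + p.2 ∧ p.1 + p.2 < l + 1 + M)
    {j : ℤ} (hj1 : 1 ≤ j) (hj : l + 1 ≤ m + j) (hj' : m + j ≤ l + 1 + M) {t : ℕ} {x y : ℤ}
    (hx : 1 ≤ x) (hxm : x ≤ m) (hp : x - y + t = m) (hs : l + 1 ≤ x + min n y)
    (hs' : x + min n y ≤ l + 1 + M) :
    (#(tracks m n Y t (x, y) j) : ℤ) = stripCount l M m j (x, min n y) := by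
  have hY : ∀ p ∈ Y, 1 ≤ p.1 ∧ p.1 ≤ m ∧ 1 ≤ p.2 ∧ p.2 ≤ n := fun p hp => by
    have := (hYm p).1 hp
    omega
  induction t generalizing x y with
  | zero =>
    rw [stripCount_of_unreachable hM hj hj' hs hs' (by push_cast at hp; omega)]
    rw [tracks, if_neg (by simp only [Prod.mk.injEq]; omega)]
    simp
  | succ t ih =>
    rw [card_tracks_succ hY hj1 hp]
    push_cast at hp ⊢
    have hxm' : ¬ m < x := by omega
    by_cases hy : n < y
    · simp only [nextPts, hxm', hy, if_true, if_false, sum_singleton]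
      have e : min n (y - 1) = min n y := by omega
      rw [ih hx hxm (by omega) (by omega) (by omega), e]
    · have e1 : min n y = y := by omega
      have e2 : min n (y - 1) = y - 1 := by omega
      rw [e1] at hs hs' ⊢
      by_cases hmem : (x, y) ∈ Y
      · simp only [nextPts, hxm', hy, hmem, if_true, if_false]
        have h1 := (hYm _).1 hmem
        simp only at h1
        rw [sum_pair (by simp), stripCount_rec hM hj hj' (by omega) (by omega),
          ih hx hxm (by omega) (by omega) (by omega), e2]
        by_cases hxe : x = m
        · subst hxe
          rw [card_tracks_of_lt hY hj1 (by simp only; omega) (by simp),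
            stripCount_of_unreachable hM hj hj' (x := x + 1) (by omega) (by omega) (by omega)]
          simp
          ring
        · rw [ih (by omega) (by omega) (by omega) (by omega) (by omega), e1, if_neg (by simp [hxe])]
          ring
      · simp only [nextPts, hxm', hy, hmem, if_false, sum_empty]
        rw [hYm] at hmem
        simp only at hmem
        by_cases hb : x + y = l + 1 ∨ x + y = l + 1 + M
        · rw [stripCount_boundary hb]
        · rw [stripCount_of_unreachable hM hj hj' hs hs' (by omega)]

theorem finsum_Tset_eq {k l m n : ℤ} (hM : 0 < m - k + (n - l)) (N i : ℤ) :
    ∑ᶠ p ∈ Tset, (-1 : ℤ) ^ (p.1 + p.2).natAbs *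
      ibinom N (m - 1 + (p.1 - p.2 - 1) * (i - 1) + p.1 * (k - m) + p.2 * (l - n)) =
    periodicBinom (m - k + (n - l)) N (m - i) -
      periodicBinom (m - k + (n - l)) N (m - l - 1 + n) := by
  set f : ℤ × ℤ → ℤ := fun p => (-1 : ℤ) ^ (p.1 + p.2).natAbs *
      ibinom N (m - 1 + (p.1 - p.2 - 1) * (i - 1) + p.1 * (k - m) + p.2 * (l - n)) with hf
  have hT : Tset = Set.range (fun a : ℤ => (a, a)) ∪ Set.range (fun a : ℤ => (a, a - 1)) := by
    ext ⟨a, b⟩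
    simp only [Tset, Set.mem_ofPred_eq, Set.mem_union, Set.mem_range, Prod.mk.injEq,
      exists_eq_left]
    omega
  have f1 : ∀ a : ℤ, f (a, a) = ibinom N (m - i - a * (m - k + (n - l))) := by
    intro a
    simp only [hf]
    rw [Even.neg_one_pow (by rw [Int.natAbs_even]; exact ⟨a, rfl⟩), one_mul]
    congr 1
    ring
  have f2 : ∀ a : ℤ, f (a, a - 1) = -ibinom N (m - l - 1 + n - a * (m - k + (n - l))) := by
    intro a
    simp only [hf]
    rw [Odd.neg_one_pow (by rw [Int.natAbs_odd]; exact ⟨a - 1, by ring⟩), neg_one_mul]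
    congr 2
    ring
  have i1 : Function.Injective (fun a : ℤ => (a, a)) := fun a b h => congrArg Prod.fst h
  have i2 : Function.Injective (fun a : ℤ => (a, a - 1)) := fun a b h => congrArg Prod.fst h
  change ∑ᶠ p ∈ Tset, f p = _
  clear_value f
  rw [hT, finsum_mem_union', finsum_mem_range i1, finsum_mem_range i2]
  · simp only [f1, f2, finsum_neg_distrib, periodicBinom]
    ring
  · rw [Set.disjoint_left]
    rintro _ ⟨a, rfl⟩ ⟨b, hb⟩
    simp only [Prod.mk.injEq] at hb
    omega
  · refine ((finite_support_ibinom hM N (m - i)).image fun a : ℤ => (a, a)).subset ?_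
    rintro _ ⟨⟨a, rfl⟩, ha⟩
    refine ⟨a, ?_, rfl⟩
    rw [Function.mem_support, f1] at ha
    exact ha
  · refine ((finite_support_ibinom hM N (m - l - 1 + n)).image fun a : ℤ => (a, a - 1)).subset ?_
    rintro _ ⟨⟨a, rfl⟩, ha⟩
    refine ⟨a, ?_, rfl⟩
    rw [Function.mem_support, f2] at ha
    simpa using ha

theorem nipCount_eq_card_disjointTracks (hY : ∀ p ∈ Y, 1 ≤ p.1 ∧ p.1 ≤ m ∧ 1 ≤ p.2 ∧ p.2 ≤ n)
    {t r : ℕ} {x j : Fin r → ℤ} {y : Fin r → ℤ} (hj : ∀ i, 1 ≤ j i) (hx : ∀ i, x i ≤ m)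
    (hy : ∀ i, n ≤ y i) (hp : ∀ i, x i - y i + t = m) :
    nipCount Y (fun i => (x i, n)) (fun i => (m, j i)) =
      #(disjointTracks m n Y t (fun i => (x i, y i)) j) := by
  unfold nipCount
  refine Nat.subtype_card _ fun C => ?_
  rw [mem_disjointTracks]
  refine and_congr_left' (forall_congr' fun i => ?_)
  rw [mem_tracks_iff hY (hj i) (hp i), IsTrack, if_neg (by simpa using hx i)]
  split_ifs with h
  · rfl
  · have : y i = n := le_antisymm (not_lt.1 h) (hy i)
    rw [this]

end Ladder

theorem stmt14 (m n k l : ℤ) (r : ℕ) (hk0 : 0 ≤ k) (hl0 : 0 ≤ l)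
    (hk : k ≤ min (m - 2) (n - 2)) (hl : l ≤ min (m - 2) (n - 2))
    (hr : 1 ≤ r) (hrm : (r : ℤ) < min (m - k) (n - l))
    (Y : Set (ℤ × ℤ))
    (hY : Y = {p : ℤ × ℤ | 1 ≤ p.1 ∧ p.1 ≤ m ∧
      max 1 (l + 2 - p.1) ≤ p.2 ∧ p.2 ≤ min n (n + m - k - p.1)}) :
    (nipCount Y (fun i : Fin r => (((i : ℕ) : ℤ) + 1, n))
        (fun i : Fin r => (m, ((i : ℕ) : ℤ) + 1)) : ℤ) =
      Matrix.det (Matrix.of fun i j : Fin r =>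
        ∑ᶠ p ∈ Tset, (-1 : ℤ) ^ (p.1 + p.2).natAbs *
          ibinom (m + n - (((i : ℕ) : ℤ) + 1) - (((j : ℕ) : ℤ) + 1))
            (m - 1 + (p.1 - p.2 - 1) * ((((i : ℕ) : ℤ) + 1) - 1) +
              p.1 * (k - m) + p.2 * (l - n))) := by
  simp only [le_min_iff, lt_min_iff] at hk hl hrm
  have hM : 0 < m - k + (n - l) := by omega
  have hYm : ∀ p : ℤ × ℤ, p ∈ Y ↔ (1 ≤ p.1 ∧ p.1 ≤ m) ∧ (1 ≤ p.2 ∧ p.2 ≤ n) ∧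
      l + 1 < p.1 + p.2 ∧ p.1 + p.2 < l + 1 + (m - k + (n - l)) := by
    intro p
    rw [hY, Set.mem_ofPred_eq]
    omega
  have hYb : ∀ p ∈ Y, 1 ≤ p.1 ∧ p.1 ≤ m ∧ 1 ≤ p.2 ∧ p.2 ≤ n := fun p hp => by
    have := (hYm p).1 hp
    omega
  have hcol : ∀ i j : Fin r, ((j : ℕ) : ℤ) + 1 ≤ n - k + 1 →
      (Finset.card (tracks m n Y (m + n - 1).toNat
        (((i : ℕ) : ℤ) + 1, n + ((i : ℕ) : ℤ)) (((j : ℕ) : ℤ) + 1)) : ℤ) =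
      ∑ᶠ p ∈ Tset, (-1 : ℤ) ^ (p.1 + p.2).natAbs *
          ibinom (m + n - (((i : ℕ) : ℤ) + 1) - (((j : ℕ) : ℤ) + 1))
            (m - 1 + (p.1 - p.2 - 1) * ((((i : ℕ) : ℤ) + 1) - 1) +
              p.1 * (k - m) + p.2 * (l - n)) := by
    intro i j hj
    have hi := i.2
    have e : min n (n + ((i : ℕ) : ℤ)) = n := by omega
    rw [finsum_Tset_eq hM, card_tracks_eq_stripCount hM hYm (by omega) (by omega) (by omega)
      (by omega) (by omega) (by omega) (by omega) (by omega), e, stripCount]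
    congr 2 <;> ring
  have hnip := nipCount_eq_card_disjointTracks hYb (t := (m + n - 1).toNat)
    (x := fun i : Fin r => ((i : ℕ) : ℤ) + 1) (j := fun i : Fin r => ((i : ℕ) : ℤ) + 1)
    (y := fun i : Fin r => n + ((i : ℕ) : ℤ)) (fun i => by omega)
    (fun i => by have := i.2; omega) (fun i => by omega) (fun i => by omega)
  by_cases hr' : (r : ℤ) ≤ n - k + 1
  · rw [hnip, card_disjointTracks_eq_det hYb (fun i => by omega) (fun a b hab => by simpa using hab)
      (fun a b hab => by simpa using hab) (fun i => by simp only; omega)]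
    congr 2
    ext i j
    exact hcol i j (by have := j.2; omega)
  · -- the end point on the upper boundary line of the ladder is unreachable
    set j : Fin r := ⟨(n - k).toNat, by omega⟩ with hjdef
    have hjv : ((j : ℕ) : ℤ) = n - k := by simp only [hjdef]; omega
    have hjY : (m, ((j : ℕ) : ℤ) + 1) ∉ Y := by
      rw [hYm]
      simp only
      omega
    rw [Matrix.det_eq_zero_of_column_eq_zero j]
    · unfold nipCount
      rw [Nat.cast_eq_zero, Nat.card_eq_zero]
      exact Or.inl ⟨fun C => hjY (C.2.1 j).end_mem⟩
    · intro i
      refine (hcol i j (by omega)).symm.trans ?_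
      rw [Nat.cast_eq_zero, Finset.card_eq_zero, Finset.eq_empty_iff_forall_notMem]
      intro c hc
      rw [mem_tracks_iff hYb (by omega) (by simp only; omega), IsTrack,
        if_neg (by have := i.2; simp only; omega)] at hc
      split_ifs at hc
      · exact hjY hc.end_mem
      · exact hjY hc.end_mem
end
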